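/- Let Θ > 0, (u,v) ∈ S_Θ × S_Θ, and let τ* > 0 satisfy Q(u^{τ*}, v^{τ*}) = 0. Then I(u^τ, v^τ) < I(u^{τ*}, v^{τ*}) for every τ > 0 with τ ≠ τ*. -/

import Mathlib

noncomputable section

open MeasureTheory Real Filter

namespace Waveguide

/-- A point of the waveguide `ℝ³ × 𝕋`, modelled as `ℝ³ × ℝ` with functions that are
`2π`-periodic in the second coordinate. -/
abbrev Pt : Type := (Fin 3 → ℝ) × ℝ

/-- The fundamental domain `ℝ³ × (0, 2π]` of the waveguide `ℝ³ × 𝕋`. -/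
def Dom : Set Pt := Set.univ ×ˢ Set.Ioc 0 (2 * π)

/-- `2π`-periodicity in the `y` variable. -/
def PeriodicY (u : Pt → ℝ) : Prop := ∀ x y, u (x, y + 2 * π) = u (x, y)

/-- The `i`-th horizontal coordinate direction. -/
def ex (i : Fin 3) : Pt := (fun j => if j = i then 1 else 0, 0)

/-- The vertical (periodic) direction. -/
def ey : Pt := (0, 1)

/-- `i`-th partial derivative in the `x` variables. -/
def gradx (u : Pt → ℝ) (p : Pt) (i : Fin 3) : ℝ := fderiv ℝ u p (ex i)

/-- Partial derivative in the `y` variable, `u_y`. -/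
def grady (u : Pt → ℝ) (p : Pt) : ℝ := fderiv ℝ u p ey

/-- `|∇_x u|²`. -/
def gradSqX (u : Pt → ℝ) (p : Pt) : ℝ := ∑ i, (gradx u p i) ^ 2

/-- `|∇_{x,y} u|²`. -/
def gradSq (u : Pt → ℝ) (p : Pt) : ℝ := gradSqX u p + (grady u p) ^ 2

/-- Membership in (a regular repesentative of) `H¹(ℝ³ × 𝕋)`, for real valued functions. -/
structure H1 (u : Pt → ℝ) : Prop where
  periodic : PeriodicY u
  diff : Differentiable ℝ u
  memL2 : IntegrableOn (fun p => (u p) ^ 2) Dom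
  memGrad : IntegrableOn (fun p => gradSq u p) Dom
  memL4 : IntegrableOn (fun p => (u p) ^ 4) Dom

/-- The `L²(ℝ³ × 𝕋)` norm. -/
def l2 (u : Pt → ℝ) : ℝ := Real.sqrt (∫ p in Dom, (u p) ^ 2)

/-- `u ∈ S_Θ`. -/
def inS (Θ : ℝ) (u : Pt → ℝ) : Prop := H1 u ∧ l2 u = Θ

/-- The nonlinear density `u⁴ + 2u²v² + v⁴`. -/
def nonlin (u v : Pt → ℝ) (p : Pt) : ℝ :=
  (u p) ^ 4 + 2 * (u p) ^ 2 * (v p) ^ 2 + (v p) ^ 4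

/-- The energy functional `I(u,v)`. -/
def energy (u v : Pt → ℝ) : ℝ :=
  (1 / 2) * (∫ p in Dom, (gradSq u p + gradSq v p))
    - (1 / 4) * ∫ p in Dom, nonlin u v p

/-- The semivirial functional `Q(u,v)`. -/
def svirial (u v : Pt → ℝ) : ℝ :=
  (∫ p in Dom, (gradSqX u p + gradSqX v p))
    - (3 / 4) * ∫ p in Dom, nonlin u v p

/-- The ground-state level `m_Θ`. -/
def mlevel (Θ : ℝ) : ℝ :=
  sInf {c | ∃ u v : Pt → ℝ, inS Θ u ∧ inS Θ v ∧ svirial u v = 0 ∧ energy u v = c}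

/-- `(u,v)` is a minimizer of `m_Θ`: it lies in `V_Θ` and attains the infimum. -/
def isMinimizer (Θ : ℝ) (u v : Pt → ℝ) : Prop :=
  inS Θ u ∧ inS Θ v ∧ svirial u v = 0 ∧ energy u v = mlevel Θ

/-- Smooth, compactly supported (in `x`) test function on the waveguide. -/
def TestFun (φ : Pt → ℝ) : Prop :=
  ContDiff ℝ (⊤ : ℕ∞) φ ∧ PeriodicY φ ∧
    ∃ K : Set (Fin 3 → ℝ), IsCompact K ∧ ∀ p : Pt, p.1 ∉ K → φ p = 0

/-- `u` is a weak solution of `-Δ_{x,y} u + lam u = f` on `ℝ³ × 𝕋`. -/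
def WeakSol (lam : ℝ) (u f : Pt → ℝ) : Prop :=
  ∀ φ : Pt → ℝ, TestFun φ →
    (∫ p in Dom,
        ((∑ i, gradx u p i * gradx φ p i) + grady u p * grady φ p + lam * u p * φ p))
      = ∫ p in Dom, f p * φ p

/-- The mass-preserving rescaling `u^τ(x,y) = τ^{3/2} u(τx, y)`. -/
def scaleX (τ : ℝ) (u : Pt → ℝ) : Pt → ℝ :=
  fun p => τ ^ ((3 : ℝ) / 2) * u (τ • p.1, p.2)

/-- `u` is independent of the `y` variable, i.e. `u_y = 0` (a.e.). -/
def Yindep (u : Pt → ℝ) : Prop := ∀ᵐ p : Pt ∂volume, grady u p = 0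

/-- The functional `J_μ(u,v)`. -/
def Jfun (μ : ℝ) (u v : Pt → ℝ) : ℝ :=
  (1 / 2) * (∫ p in Dom,
      (gradSqX u p + μ * (grady u p) ^ 2 + gradSqX v p + μ * (grady v p) ^ 2))
    - (1 / 4) * ∫ p in Dom, nonlin u v p

/-- The level `m_{1,μ}`. -/
def m1 (μ : ℝ) : ℝ :=
  sInf {c | ∃ u v : Pt → ℝ, inS 1 u ∧ inS 1 v ∧ svirial u v = 0 ∧ Jfun μ u v = c}

/-- `(u,v)` is a minimizer of `m_{1,μ}`. -/
def isMinimizerJ (μ : ℝ) (u v : Pt → ℝ) : Prop :=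
  inS 1 u ∧ inS 1 v ∧ svirial u v = 0 ∧ Jfun μ u v = m1 μ

/-! ### Objects on `ℝ³` -/

abbrev Pt3 : Type := Fin 3 → ℝ

def e3 (i : Fin 3) : Pt3 := fun j => if j = i then 1 else 0

def grad3 (w : Pt3 → ℝ) (x : Pt3) (i : Fin 3) : ℝ := fderiv ℝ w x (e3 i)

def gradSq3 (w : Pt3 → ℝ) (x : Pt3) : ℝ := ∑ i, (grad3 w x i) ^ 2

/-- Membership in (a regular representative of) `H¹(ℝ³)`. -/
structure H1R3 (w : Pt3 → ℝ) : Prop where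
  diff : Differentiable ℝ w
  memL2 : Integrable (fun x => (w x) ^ 2)
  memGrad : Integrable (fun x => gradSq3 w x)
  memL4 : Integrable (fun x => (w x) ^ 4)

/-- The `L²(ℝ³)` norm. -/
def l2R3 (w : Pt3 → ℝ) : ℝ := Real.sqrt (∫ x, (w x) ^ 2)

def nonlin3 (u v : Pt3 → ℝ) (x : Pt3) : ℝ :=
  (u x) ^ 4 + 2 * (u x) ^ 2 * (v x) ^ 2 + (v x) ^ 4

/-- The limit energy `Î(u,v)` on `ℝ³`. -/
def Ihat (u v : Pt3 → ℝ) : ℝ :=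
  (1 / 2) * (∫ x, (gradSq3 u x + gradSq3 v x)) - (1 / 4) * ∫ x, nonlin3 u v x

/-- The virial `Q̂(u,v)` on `ℝ³`. -/
def Qhat (u v : Pt3 → ℝ) : ℝ :=
  (∫ x, (gradSq3 u x + gradSq3 v x)) - (3 / 4) * ∫ x, nonlin3 u v x

/-- The ground-state energy `m̂_ρ` on `ℝ³`. -/
def mhat (ρ : ℝ) : ℝ :=
  sInf {c | ∃ u v : Pt3 → ℝ, H1R3 u ∧ H1R3 v ∧ l2R3 u = ρ ∧ l2R3 v = ρ ∧
    Qhat u v = 0 ∧ Ihat u v = c}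


theorem dom_restrict :
    (volume : Measure Pt).restrict Dom
      = (volume : Measure (Fin 3 → ℝ)).prod (volume.restrict (Set.Ioc 0 (2 * π))) := by
  rw [Dom, Measure.volume_eq_prod, ← Measure.prod_restrict, Measure.restrict_univ]

theorem setIntegral_dom_comp_scale {τ : ℝ} (hτ : 0 < τ) (f : Pt → ℝ) :
    ∫ p in Dom, f (τ • p.1, p.2) = (τ ^ 3)⁻¹ * ∫ p in Dom, f p := by
  have hne : τ ≠ 0 := hτ.ne'
  let e : Pt ≃ᵐ Pt := ((Homeomorph.smulOfNeZero τ hne).toMeasurableEquiv).prodCongr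
    (MeasurableEquiv.refl ℝ)
  have hmap : ((volume : Measure Pt).restrict Dom).map e
      = ENNReal.ofReal ((τ ^ 3)⁻¹) • (volume : Measure Pt).restrict Dom := by
    have he : (e : Pt → Pt) = Prod.map (fun x : Fin 3 → ℝ => τ • x) id := rfl
    rw [dom_restrict, he, ← Measure.map_prod_map _ _ (measurable_const_smul τ) measurable_id,
      Measure.map_id, Measure.map_addHaar_smul _ hne, Measure.prod_smul_left]
    rw [Module.finrank_fin_fun, abs_of_pos (by positivity)]
  have h := integral_map_equiv (μ := (volume : Measure Pt).restrict Dom) e f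
  rw [hmap, integral_smul_measure, ENNReal.toReal_ofReal (by positivity), smul_eq_mul] at h
  exact h.symm

theorem rpow_three_halves_sq {τ : ℝ} (hτ : 0 < τ) : (τ ^ ((3 : ℝ) / 2)) ^ 2 = τ ^ 3 := by
  rw [← Real.rpow_natCast, ← Real.rpow_mul hτ.le, ← Real.rpow_natCast]
  norm_num

theorem fderiv_scaleX {u : Pt → ℝ} (hu : Differentiable ℝ u) (τ : ℝ) (p w : Pt) :
    fderiv ℝ (scaleX τ u) p w
      = τ ^ ((3 : ℝ) / 2) * fderiv ℝ u (τ • p.1, p.2) (τ • w.1, w.2) := by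
  let L : Pt →L[ℝ] Pt :=
    (τ • ContinuousLinearMap.fst ℝ (Fin 3 → ℝ) ℝ).prod (ContinuousLinearMap.snd ℝ _ ℝ)
  have h : HasFDerivAt (scaleX τ u) (τ ^ ((3 : ℝ) / 2) • (fderiv ℝ u (L p)).comp L) p :=
    ((hu (L p)).hasFDerivAt.comp p L.hasFDerivAt).const_mul _
  rw [h.fderiv]
  rfl

theorem gradSqX_scaleX {u : Pt → ℝ} (hu : Differentiable ℝ u) {τ : ℝ} (hτ : 0 < τ) (p : Pt) :
    gradSqX (scaleX τ u) p = τ ^ 5 * gradSqX u (τ • p.1, p.2) := by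
  have hw (i : Fin 3) : ((τ • (ex i).1, (ex i).2) : Pt) = τ • ex i := by
    ext <;> simp [ex]
  simp only [gradSqX, gradx, Finset.mul_sum]
  refine Finset.sum_congr rfl fun i _ => ?_
  rw [fderiv_scaleX hu, hw, map_smul, smul_eq_mul, mul_pow, rpow_three_halves_sq hτ]
  ring

theorem grady_scaleX_sq {u : Pt → ℝ} (hu : Differentiable ℝ u) {τ : ℝ} (hτ : 0 < τ) (p : Pt) :
    grady (scaleX τ u) p ^ 2 = τ ^ 3 * grady u (τ • p.1, p.2) ^ 2 := by
  have hw : ((τ • ey.1, ey.2) : Pt) = ey := by ext <;> simp [ey]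
  rw [grady, fderiv_scaleX hu, hw, mul_pow, rpow_three_halves_sq hτ, grady]

theorem nonlin_scaleX (u v : Pt → ℝ) {τ : ℝ} (hτ : 0 < τ) (p : Pt) :
    nonlin (scaleX τ u) (scaleX τ v) p = τ ^ 6 * nonlin u v (τ • p.1, p.2) := by
  simp only [nonlin, scaleX]
  have h := rpow_three_halves_sq hτ
  have h4 : (τ ^ ((3 : ℝ) / 2)) ^ 4 = τ ^ 6 := by
    rw [show (4 : ℕ) = 2 * 2 from rfl, pow_mul, h]; ring
  simp only [mul_pow, h, h4]
  ring

theorem gradSqX_nonneg (u : Pt → ℝ) (p : Pt) : 0 ≤ gradSqX u p :=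
  Finset.sum_nonneg fun _ _ => sq_nonneg _

theorem measurable_gradSqX (u : Pt → ℝ) : Measurable (gradSqX u) := by
  unfold gradSqX gradx
  exact Finset.measurable_fun_sum _ fun i _ =>
    (measurable_fderiv_apply_const ℝ u (ex i)).pow_const 2

theorem H1.integrableOn_gradSqX {u : Pt → ℝ} (hu : H1 u) : IntegrableOn (gradSqX u) Dom := by
  refine hu.memGrad.mono' (measurable_gradSqX u).aestronglyMeasurable (.of_forall fun p => ?_)
  rw [Real.norm_of_nonneg (gradSqX_nonneg u p)]
  exact le_add_of_nonneg_right (sq_nonneg _)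

theorem H1.integrableOn_grady_sq {u : Pt → ℝ} (hu : H1 u) :
    IntegrableOn (fun p => grady u p ^ 2) Dom := by
  refine hu.memGrad.mono'
    ((measurable_fderiv_apply_const ℝ u ey).pow_const 2).aestronglyMeasurable
    (.of_forall fun p => ?_)
  rw [Real.norm_of_nonneg (sq_nonneg _)]
  exact le_add_of_nonneg_left (gradSqX_nonneg u p)

theorem integrableOn_nonlin {u v : Pt → ℝ} (hu : H1 u) (hv : H1 v) :
    IntegrableOn (nonlin u v) Dom := by
  have hc : Continuous (nonlin u v) := by
    have := hu.diff.continuous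
    have := hv.diff.continuous
    unfold nonlin
    fun_prop
  refine ((hu.memL4.add hv.memL4).const_mul 2).mono' hc.aestronglyMeasurable
    (.of_forall fun p => ?_)
  rw [Real.norm_of_nonneg (by unfold nonlin; positivity)]
  simp only [nonlin, Pi.add_apply]
  nlinarith [sq_nonneg (u p ^ 2 - v p ^ 2)]

theorem setIntegral_nonlin_pos {Θ : ℝ} (hΘ : 0 < Θ) {u v : Pt → ℝ} (hu : inS Θ u) (hv : H1 v) :
    0 < ∫ p in Dom, nonlin u v p := by
  have hn : ∀ p, 0 ≤ nonlin u v p := fun p => by unfold nonlin; positivity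
  refine (integral_nonneg hn).lt_of_ne' fun h0 => ?_
  have hae := (integral_eq_zero_iff_of_nonneg hn (integrableOn_nonlin hu.1 hv)).1 h0
  have hsq : ∫ p in Dom, u p ^ 2 = 0 := by
    refine integral_eq_zero_of_ae (hae.mono fun p hp => ?_)
    simp only [nonlin, Pi.zero_apply] at hp ⊢
    have h4 : u p ^ 4 = 0 := le_antisymm
      (by nlinarith [sq_nonneg (u p * v p), sq_nonneg (v p ^ 2)]) (by positivity)
    simp [pow_eq_zero_iff (n := 4) (by norm_num) |>.1 h4]
  have := hu.2
  rw [l2, hsq, Real.sqrt_zero] at this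
  exact hΘ.ne this

theorem setIntegral_nonlin_scaleX (u v : Pt → ℝ) {τ : ℝ} (hτ : 0 < τ) :
    ∫ p in Dom, nonlin (scaleX τ u) (scaleX τ v) p = τ ^ 3 * ∫ p in Dom, nonlin u v p := by
  simp only [nonlin_scaleX u v hτ, integral_const_mul]
  rw [setIntegral_dom_comp_scale hτ (nonlin u v)]
  field_simp

theorem svirial_scaleX {u v : Pt → ℝ} (hu : H1 u) (hv : H1 v) {τ : ℝ} (hτ : 0 < τ) :
    svirial (scaleX τ u) (scaleX τ v)
      = τ ^ 2 * (∫ p in Dom, (gradSqX u p + gradSqX v p))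
        - (3 / 4) * (τ ^ 3 * ∫ p in Dom, nonlin u v p) := by
  rw [svirial, setIntegral_nonlin_scaleX u v hτ]
  simp only [gradSqX_scaleX hu.diff hτ, gradSqX_scaleX hv.diff hτ, ← mul_add, integral_const_mul]
  rw [setIntegral_dom_comp_scale hτ (fun p => gradSqX u p + gradSqX v p)]
  field_simp

theorem energy_scaleX {u v : Pt → ℝ} (hu : H1 u) (hv : H1 v) {τ : ℝ} (hτ : 0 < τ) :
    energy (scaleX τ u) (scaleX τ v)
      = (1 / 2) * (τ ^ 2 * (∫ p in Dom, (gradSqX u p + gradSqX v p))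
          + ∫ p in Dom, (grady u p ^ 2 + grady v p ^ 2))
        - (1 / 4) * (τ ^ 3 * ∫ p in Dom, nonlin u v p) := by
  rw [energy, setIntegral_nonlin_scaleX u v hτ]
  have hX : IntegrableOn (fun p => gradSqX u p + gradSqX v p) Dom :=
    hu.integrableOn_gradSqX.add hv.integrableOn_gradSqX
  have hY : IntegrableOn (fun p => grady u p ^ 2 + grady v p ^ 2) Dom :=
    hu.integrableOn_grady_sq.add hv.integrableOn_grady_sq
  have hpt (p : Pt) : gradSq (scaleX τ u) p + gradSq (scaleX τ v) p
      = (fun q => τ ^ 5 * (gradSqX u q + gradSqX v q)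
          + τ ^ 3 * (grady u q ^ 2 + grady v q ^ 2)) (τ • p.1, p.2) := by
    simp only [gradSq, gradSqX_scaleX hu.diff hτ, gradSqX_scaleX hv.diff hτ,
      grady_scaleX_sq hu.diff hτ, grady_scaleX_sq hv.diff hτ]
    ring
  simp only [hpt]
  rw [setIntegral_dom_comp_scale hτ (fun q => τ ^ 5 * (gradSqX u q + gradSqX v q)
    + τ ^ 3 * (grady u q ^ 2 + grady v q ^ 2)),
    integral_add (hX.const_mul _) (hY.const_mul _),
    integral_const_mul, integral_const_mul]
  field_simp

/-- `I(u^τ, v^τ) < I(u^{τ*}, v^{τ*})` for every `τ > 0` with `τ ≠ τ*`. -/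
theorem energy_strict_max_at_virial_scaling (Θ : ℝ) (hΘ : 0 < Θ) (u v : Pt → ℝ)
    (hu : inS Θ u) (hv : inS Θ v) (τs : ℝ) (hτs : 0 < τs)
    (hQ : svirial (scaleX τs u) (scaleX τs v) = 0) :
    ∀ τ : ℝ, 0 < τ → τ ≠ τs →
      energy (scaleX τ u) (scaleX τ v) < energy (scaleX τs u) (scaleX τs v) := by
  intro τ hτ hne
  rw [svirial_scaleX hu.1 hv.1 hτs] at hQ
  rw [energy_scaleX hu.1 hv.1 hτ, energy_scaleX hu.1 hv.1 hτs]
  have hB := setIntegral_nonlin_pos hΘ hu hv.1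
  set A := ∫ p in Dom, (gradSqX u p + gradSqX v p)
  set B := ∫ p in Dom, nonlin u v p
  have hA : A = 3 / 4 * τs * B := by
    refine mul_left_cancel₀ (pow_ne_zero 2 hτs.ne') ?_
    linear_combination hQ
  have hpos : 0 < B / 8 * ((τs - τ) ^ 2 * (τs + 2 * τ)) := by
    have := pow_pos (abs_pos.2 (sub_ne_zero.2 hne.symm)) 2
    rw [sq_abs] at this
    positivity
  rw [hA]
  linarith

end Waveguide
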